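/- arXiv:1107.5566 — 4 statements merged into one kernel-verified Lean document; each statement's English description precedes it below -/
import Mathlib

section
/- One has ∫_{ℝ^N₊} w₀(ξ) Z₀(ξ) dξ = − ∫_{ℝ^N₊} w₀(ξ)² dξ; in particular this integral is strictly negative. -/
open MeasureTheory

noncomputable section

/-- Partial derivative in the `i`-th coordinate direction. -/
def pd {N : ℕ} (i : Fin N) (f : EuclideanSpace ℝ (Fin N) → ℝ)
    (ξ : EuclideanSpace ℝ (Fin N)) : ℝ :=
  fderiv ℝ f ξ (EuclideanSpace.single i 1)

/-- The Laplacian, as the sum of the pure second partial derivatives. -/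
def lap {N : ℕ} (f : EuclideanSpace ℝ (Fin N) → ℝ)
    (ξ : EuclideanSpace ℝ (Fin N)) : ℝ :=
  ∑ i : Fin N, pd i (pd i f) ξ

/-- The standard bubble `w₀(ξ) = α_N (1+|ξ|²)^{-(N-2)/2}`,
with `α_N = (N(N-2))^{(N-2)/4}`. -/
def w0 (N : ℕ) (ξ : EuclideanSpace ℝ (Fin N)) : ℝ :=
  ((N : ℝ) * ((N : ℝ) - 2)) ^ (((N : ℝ) - 2) / 4) *
    (1 + ‖ξ‖ ^ 2) ^ (-(((N : ℝ) - 2) / 2))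

/-- The index of the last coordinate `ξ_N`. -/
def lastIdx (N : ℕ) (h : 0 < N) : Fin N := ⟨N - 1, Nat.sub_lt h Nat.one_pos⟩

/-- The open upper half space `ℝ^N₊ = {ξ : ξ_N > 0}`. -/
def upperHalf (N : ℕ) (h : 0 < N) : Set (EuclideanSpace ℝ (Fin N)) :=
  {ξ | 0 < ξ (lastIdx N h)}

/-- The function `Z₀(ξ) = ξ·∇w₀(ξ) + ((N-2)/2) w₀(ξ)`. -/
def Zdil (N : ℕ) (ξ : EuclideanSpace ℝ (Fin N)) : ℝ :=
  (∑ i, ξ i * pd i (w0 N) ξ) + ((N : ℝ) - 2) / 2 * w0 N ξ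

lemma w0_sq_eq {N : ℕ} (ξ : EuclideanSpace ℝ (Fin N)) :
    w0 N ξ ^ 2 = (((N : ℝ) * ((N : ℝ) - 2)) ^ (((N : ℝ) - 2) / 4)) ^ 2 *
      (1 + ‖ξ‖ ^ 2) ^ (-((N : ℝ) - 2)) := by
  rw [w0, mul_pow, ← Real.rpow_natCast ((1 + ‖ξ‖ ^ 2) ^ _), ← Real.rpow_mul (by positivity)]
  congr 2
  push_cast
  ring

lemma w0_pos {N : ℕ} (hN : 5 ≤ N) (ξ : EuclideanSpace ℝ (Fin N)) : 0 < w0 N ξ := by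
  have hN' : (5 : ℝ) ≤ N := by exact_mod_cast hN
  have h : 0 < (N : ℝ) * ((N : ℝ) - 2) := by nlinarith
  unfold w0
  positivity

lemma differentiable_w0 (N : ℕ) : Differentiable ℝ (w0 N) := by
  intro ξ
  unfold w0
  have h : DifferentiableAt ℝ (fun ξ : EuclideanSpace ℝ (Fin N) => 1 + ‖ξ‖ ^ 2) ξ :=
    (differentiableAt_const _).add (differentiableAt_id.norm_sq ℝ)
  exact (h.rpow_const (Or.inl (by positivity))).const_mul _

lemma integrable_w0_sq {N : ℕ} (hN : 5 ≤ N) :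
    Integrable (fun ξ : EuclideanSpace ℝ (Fin N) => w0 N ξ ^ 2) := by
  have hN' : (5 : ℝ) ≤ N := by exact_mod_cast hN
  simp_rw [w0_sq_eq]
  have h := integrable_rpow_neg_one_add_norm_sq (E := EuclideanSpace ℝ (Fin N))
    (μ := volume) (r := 2 * ((N : ℝ) - 2)) (by simp; linarith)
  refine Integrable.const_mul ?_ _
  convert h using 3
  ring

/-- The Euler operator `ξ ↦ ξ·∇f(ξ)` is the derivative in the radial direction. -/
lemma sum_mul_pd_eq {N : ℕ} (f : EuclideanSpace ℝ (Fin N) → ℝ)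
    (ξ : EuclideanSpace ℝ (Fin N)) : ∑ i, ξ i * pd i f ξ = fderiv ℝ f ξ ξ := by
  have h : ξ = ∑ i, ξ i • EuclideanSpace.single i (1 : ℝ) := by
    simpa using ((EuclideanSpace.basisFun (Fin N) ℝ).sum_repr ξ).symm
  conv_rhs => rw [h, map_sum]
  simp only [map_smul, smul_eq_mul, pd, ← h]

lemma hasDerivAt_w0_sq_smul {N : ℕ} (ξ : EuclideanSpace ℝ (Fin N)) (t : ℝ) :
    HasDerivAt (fun s : ℝ => w0 N (s • ξ) ^ 2)
      (2 * w0 N (t • ξ) * fderiv ℝ (w0 N) (t • ξ) ξ) t := by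
  have h1 : HasDerivAt (fun s : ℝ => s • ξ) ξ t := by
    simpa using (hasDerivAt_id t).smul_const ξ
  have h2 := ((differentiable_w0 N (t • ξ)).hasFDerivAt.comp_hasDerivAt t h1).fun_pow 2
  simpa using h2

lemma norm_deriv_w0_sq_smul_le {N : ℕ} (hN : 5 ≤ N) (ξ : EuclideanSpace ℝ (Fin N)) {t : ℝ}
    (ht : 1 / 2 < t) :
    ‖2 * w0 N (t • ξ) * fderiv ℝ (w0 N) (t • ξ) ξ‖ ≤
      (4 * ((N : ℝ) - 2) * 4 ^ ((N : ℝ) - 2)) * w0 N ξ ^ 2 := by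
  have hN' : (5 : ℝ) ≤ N := by exact_mod_cast hN
  set p : ℝ := (N : ℝ) - 2 with hp
  have hp0 : 0 < p := by linarith
  set C : ℝ := (((N : ℝ) * ((N : ℝ) - 2)) ^ (((N : ℝ) - 2) / 4)) ^ 2 with hC
  have hC0 : 0 ≤ C := sq_nonneg _
  set A : ℝ := 1 + t ^ 2 * ‖ξ‖ ^ 2 with hA
  have hA0 : 0 < A := by positivity
  have h1 : HasDerivAt (fun s : ℝ => 1 + s ^ 2 * ‖ξ‖ ^ 2) (2 * t * ‖ξ‖ ^ 2) t := by
    simpa using ((hasDerivAt_pow 2 t).mul_const (‖ξ‖ ^ 2)).const_add 1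
  have h2 : HasDerivAt (fun s : ℝ => w0 N (s • ξ) ^ 2)
      (C * (2 * t * ‖ξ‖ ^ 2 * (-p) * A ^ (-p - 1))) t := by
    have h := (h1.rpow_const (p := -p) (Or.inl hA0.ne')).const_mul C
    refine h.congr_of_eventuallyEq (Filter.Eventually.of_forall fun s => ?_)
    simp only [w0_sq_eq, norm_smul, mul_pow, Real.norm_eq_abs, sq_abs]
    rfl
  rw [(hasDerivAt_w0_sq_smul ξ t).unique h2, w0_sq_eq]
  have h3 : 2 * t * ‖ξ‖ ^ 2 ≤ 4 * A := by
    nlinarith [mul_nonneg (mul_nonneg (by linarith : 0 ≤ t) (by linarith : 0 ≤ 2 * t - 1))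
      (sq_nonneg ‖ξ‖)]
  have h4 : A ^ (-p) ≤ 4 ^ p * (1 + ‖ξ‖ ^ 2) ^ (-p) := by
    have h : (1 + ‖ξ‖ ^ 2) / 4 ≤ A := by
      nlinarith [mul_nonneg (by nlinarith : 0 ≤ t ^ 2 - 1 / 4) (sq_nonneg ‖ξ‖)]
    calc A ^ (-p) ≤ ((1 + ‖ξ‖ ^ 2) / 4) ^ (-p) :=
          Real.rpow_le_rpow_of_nonpos (by positivity) h (by linarith)
      _ = 4 ^ p * (1 + ‖ξ‖ ^ 2) ^ (-p) := by
          rw [Real.div_rpow (by positivity) (by norm_num), Real.rpow_neg (by norm_num : (0:ℝ) ≤ 4)]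
          field_simp
  have h5 : A * A ^ (-p - 1) = A ^ (-p) := by
    rw [Real.rpow_sub_one hA0.ne']
    field_simp
  have ht0 : 0 < t := by linarith
  have h6 : C * (2 * t * ‖ξ‖ ^ 2 * (-p) * A ^ (-p - 1)) =
      -(C * (2 * t * ‖ξ‖ ^ 2 * p * A ^ (-p - 1))) := by ring
  rw [h6, norm_neg, Real.norm_of_nonneg (by positivity)]
  calc C * (2 * t * ‖ξ‖ ^ 2 * p * A ^ (-p - 1))
      ≤ C * (4 * A * p * A ^ (-p - 1)) := by gcongr
    _ = C * (4 * p * A ^ (-p)) := by rw [← h5]; ring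
    _ ≤ C * (4 * p * (4 ^ p * (1 + ‖ξ‖ ^ 2) ^ (-p))) := by gcongr
    _ = _ := by ring

lemma isOpen_upperHalf (N : ℕ) (h : 0 < N) : IsOpen (upperHalf N h) :=
  isOpen_lt continuous_const (by fun_prop)

open scoped Pointwise in
lemma smul_upperHalf {N : ℕ} (h : 0 < N) {t : ℝ} (ht : 0 < t) :
    t • upperHalf N h = upperHalf N h := by
  ext ξ
  rw [Set.mem_smul_set_iff_inv_smul_mem₀ ht.ne']
  simp [upperHalf, ht]

open scoped Pointwise in
lemma setIntegral_w0_sq_smul {N : ℕ} (h : 0 < N) {t : ℝ} (ht : 0 < t) :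
    ∫ ξ in upperHalf N h, w0 N (t • ξ) ^ 2 =
      (t ^ N)⁻¹ * ∫ ξ in upperHalf N h, w0 N ξ ^ 2 := by
  have := Measure.setIntegral_comp_smul_of_pos volume (fun ξ => w0 N ξ ^ 2) (upperHalf N h) ht
  simpa [smul_upperHalf h ht] using this

/-- The identity `∫ ξ·∇(w₀²) = -N ∫ w₀²` on the half space, with the integrability of the left
integrand. -/
lemma integral_w0_mul_radial_fderiv {N : ℕ} (hN : 5 ≤ N) (h : 0 < N) :
    IntegrableOn (fun ξ => 2 * w0 N ξ * fderiv ℝ (w0 N) ξ ξ) (upperHalf N h) ∧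
      ∫ ξ in upperHalf N h, 2 * w0 N ξ * fderiv ℝ (w0 N) ξ ξ =
        -(N * ∫ ξ in upperHalf N h, w0 N ξ ^ 2) := by
  have hcont : Continuous (w0 N) := (differentiable_w0 N).continuous
  have key := hasDerivAt_integral_of_dominated_loc_of_deriv_le
    (μ := volume.restrict (upperHalf N h)) (x₀ := (1 : ℝ)) (s := Set.Ioi (1 / 2))
    (F := fun t ξ => w0 N (t • ξ) ^ 2)
    (F' := fun t ξ => 2 * w0 N (t • ξ) * fderiv ℝ (w0 N) (t • ξ) ξ)
    (bound := fun ξ => (4 * ((N : ℝ) - 2) * 4 ^ ((N : ℝ) - 2)) * w0 N ξ ^ 2)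
    (Ioi_mem_nhds (by norm_num))
    (Filter.Eventually.of_forall fun t => by
      have : Continuous fun ξ => w0 N (t • ξ) ^ 2 := by fun_prop
      exact this.aestronglyMeasurable)
    (by simpa only [one_smul] using (integrable_w0_sq hN).restrict)
    (by
      have h1 : Measurable fun ξ => fderiv ℝ (w0 N) ξ ξ := by
        simp_rw [← sum_mul_pd_eq, pd]
        exact Finset.measurable_sum _ fun i _ =>
          Measurable.mul (by fun_prop) (measurable_fderiv_apply_const ℝ _ _)
      simp only [one_smul]
      exact ((hcont.measurable.const_mul 2).mul h1).aestronglyMeasurable)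
    (Filter.Eventually.of_forall fun ξ t ht => norm_deriv_w0_sq_smul_le hN ξ ht)
    ((integrable_w0_sq hN).integrableOn.const_mul _)
    (Filter.Eventually.of_forall fun ξ t _ => hasDerivAt_w0_sq_smul ξ t)
  simp only [one_smul] at key
  refine ⟨key.1, key.2.unique ?_⟩
  have h1 : HasDerivAt (fun t : ℝ => (t ^ N)⁻¹ * ∫ ξ in upperHalf N h, w0 N ξ ^ 2)
      (-(N * ∫ ξ in upperHalf N h, w0 N ξ ^ 2)) 1 := by
    simpa using ((hasDerivAt_pow N (1 : ℝ)).fun_inv (by simp)).mul_const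
      (∫ ξ in upperHalf N h, w0 N ξ ^ 2)
  refine h1.congr_of_eventuallyEq ?_
  filter_upwards [Ioi_mem_nhds (zero_lt_one' ℝ)] with t ht
  exact setIntegral_w0_sq_smul h ht

lemma integral_w0_sq_pos {N : ℕ} (hN : 5 ≤ N) (h : 0 < N) :
    0 < ∫ ξ in upperHalf N h, w0 N ξ ^ 2 := by
  rw [integral_pos_iff_support_of_nonneg (fun ξ => sq_nonneg _) (integrable_w0_sq hN).integrableOn]
  have hs : Function.support (fun ξ => w0 N ξ ^ 2) = Set.univ :=
    Set.eq_univ_of_forall fun ξ => (pow_pos (w0_pos hN ξ) 2).ne'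
  rw [hs, Measure.restrict_apply_univ]
  exact (isOpen_upperHalf N h).measure_pos _ ⟨EuclideanSpace.single (lastIdx N h) 1, by
    simp [upperHalf]⟩

/-- `∫_{ℝ^N₊} w₀ Z₀ = - ∫_{ℝ^N₊} w₀²`, and this integral is
strictly negative. -/
theorem stmt2 (N : ℕ) (hN : 5 ≤ N) :
    (∫ ξ in upperHalf N (by omega), w0 N ξ * Zdil N ξ)
      = -∫ ξ in upperHalf N (by omega), (w0 N ξ) ^ 2 ∧
    (∫ ξ in upperHalf N (by omega), w0 N ξ * Zdil N ξ) < 0 := by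
  have h : 0 < N := by omega
  obtain ⟨hint, heq⟩ := integral_w0_mul_radial_fderiv hN h
  have main : (∫ ξ in upperHalf N h, w0 N ξ * Zdil N ξ)
      = -∫ ξ in upperHalf N h, (w0 N ξ) ^ 2 := by
    have hZ : ∀ ξ, w0 N ξ * Zdil N ξ = 1 / 2 * (2 * w0 N ξ * fderiv ℝ (w0 N) ξ ξ) +
        ((N : ℝ) - 2) / 2 * w0 N ξ ^ 2 := fun ξ => by
      rw [Zdil, sum_mul_pd_eq]
      ring
    simp_rw [hZ]
    rw [integral_add (hint.const_mul _) ((integrable_w0_sq hN).integrableOn.const_mul _),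
      integral_const_mul, integral_const_mul, heq]
    ring
  exact ⟨main, main ▸ neg_neg_of_pos (integral_w0_sq_pos hN h)⟩
end
end

section
/- One has ∫_{ℝ^N₊} ξ_N w₀(ξ)^{2N/(N−2)} dξ = (N(N−3)/(N−2)) 𝔄₁. -/
open MeasureTheory

noncomputable section

theorem one_add_norm_sq_pos {E : Type*} [NormedAddCommGroup E] (x : E) : 0 < 1 + ‖x‖ ^ 2 := by
  positivity

theorem hasFDerivAt_one_add_norm_sq_rpow {E : Type*} [NormedAddCommGroup E]
    [InnerProductSpace ℝ E] (a : ℝ) (x : E) :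
    HasFDerivAt (fun y : E ↦ (1 + ‖y‖ ^ 2) ^ a)
      ((a * (1 + ‖x‖ ^ 2) ^ (a - 1)) • (2 • innerSL ℝ x)) x :=
  ((hasStrictFDerivAt_norm_sq x).hasFDerivAt.const_add 1).rpow_const
    (Or.inl (one_add_norm_sq_pos x).ne')

theorem continuous_one_add_norm_sq_rpow {E : Type*} [NormedAddCommGroup E] (a : ℝ) :
    Continuous (fun y : E ↦ (1 + ‖y‖ ^ 2) ^ a) :=
  Continuous.rpow_const (by fun_prop) fun y ↦ Or.inl (one_add_norm_sq_pos y).ne'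

/-- A continuous function dominated by an integrable Japanese bracket is integrable. -/
theorem integrable_of_abs_le_one_add_norm_sq_rpow {N : ℕ} {f : EuclideanSpace ℝ (Fin N) → ℝ}
    (hf : Continuous f) {b C : ℝ} (hb : b < -(N : ℝ) / 2)
    (h : ∀ ξ, |f ξ| ≤ C * (1 + ‖ξ‖ ^ 2) ^ b) : Integrable f := by
  have hint : Integrable (fun ξ : EuclideanSpace ℝ (Fin N) ↦ (1 + ‖ξ‖ ^ 2) ^ b) := by
    have := integrable_rpow_neg_one_add_norm_sq
      (μ := (volume : Measure (EuclideanSpace ℝ (Fin N)))) (r := -2 * b)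
      (by rw [finrank_euclideanSpace_fin]; linarith)
    simpa using this
  exact (hint.const_mul C).mono' hf.aestronglyMeasurable (Filter.Eventually.of_forall h)

section PositivePart

variable {N : ℕ} (i k : Fin N) (a : ℝ) (ξ : EuclideanSpace ℝ (Fin N))

theorem posPart_coord_le : max (ξ k) 0 ≤ ‖ξ‖ :=
  max_le ((le_abs_self _).trans (PiLp.norm_apply_le ξ k)) (norm_nonneg _)

theorem integrable_posPart_mul_rpow (ha : a < -(N : ℝ) / 2 - 1) :
    Integrable fun ξ : EuclideanSpace ℝ (Fin N) ↦ max (ξ k) 0 * (1 + ‖ξ‖ ^ 2) ^ a := by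
  refine integrable_of_abs_le_one_add_norm_sq_rpow (b := a + 1) (C := 1)
    (.mul (by fun_prop) (continuous_one_add_norm_sq_rpow a)) (by linarith) fun ξ ↦ ?_
  have h0 : 0 ≤ max (ξ k) 0 := le_max_right _ _
  have h1 := posPart_coord_le k ξ
  have hJ := one_add_norm_sq_pos ξ
  rw [abs_of_nonneg (by positivity), Real.rpow_add_one hJ.ne', one_mul, mul_comm]
  gcongr
  nlinarith [sq_nonneg (‖ξ‖ - 1)]

theorem integrable_coord_mul_posPart_mul_rpow (ha : a < -(N : ℝ) / 2 - 1) :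
    Integrable fun ξ : EuclideanSpace ℝ (Fin N) ↦
      ξ i * max (ξ k) 0 * (1 + ‖ξ‖ ^ 2) ^ a := by
  refine integrable_of_abs_le_one_add_norm_sq_rpow (b := a + 1) (C := 1)
    (.mul (by fun_prop) (continuous_one_add_norm_sq_rpow a)) (by linarith) fun ξ ↦ ?_
  have h0 : 0 ≤ max (ξ k) 0 := le_max_right _ _
  have h1 := posPart_coord_le k ξ
  have h2 : |ξ i| ≤ ‖ξ‖ := PiLp.norm_apply_le ξ i
  have hJ := one_add_norm_sq_pos ξ
  rw [abs_mul, abs_mul, abs_of_nonneg h0, abs_of_pos (Real.rpow_pos_of_pos hJ a),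
    Real.rpow_add_one hJ.ne', one_mul, mul_comm]
  gcongr
  nlinarith [mul_le_mul h2 h1 h0 (norm_nonneg ξ)]

theorem integrable_coord_sq_mul_posPart_mul_rpow (ha : a < -(N : ℝ) / 2 - 1) :
    Integrable fun ξ : EuclideanSpace ℝ (Fin N) ↦
      ξ i ^ 2 * max (ξ k) 0 * (1 + ‖ξ‖ ^ 2) ^ (a - 1) := by
  refine integrable_of_abs_le_one_add_norm_sq_rpow (b := a + 1) (C := 1)
    (.mul (by fun_prop) (continuous_one_add_norm_sq_rpow _)) (by linarith) fun ξ ↦ ?_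
  have h0 : 0 ≤ max (ξ k) 0 := le_max_right _ _
  have h1 := posPart_coord_le k ξ
  have h2 : ξ i ^ 2 ≤ ‖ξ‖ ^ 2 := sq_le_sq.2 (by simpa using PiLp.norm_apply_le ξ i)
  have hJ := one_add_norm_sq_pos ξ
  have e : (1 + ‖ξ‖ ^ 2) ^ (a + 1) = (1 + ‖ξ‖ ^ 2) ^ 2 * (1 + ‖ξ‖ ^ 2) ^ (a - 1) := by
    rw [show a + 1 = a - 1 + (2 : ℕ) by push_cast; ring, Real.rpow_add_natCast hJ.ne', mul_comm]
  rw [abs_of_nonneg (by positivity), e, one_mul, sq (1 + ‖ξ‖ ^ 2)]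
  gcongr
  · linarith
  · nlinarith [sq_nonneg (‖ξ‖ - 1)]

theorem hasDerivAt_mul_posPart (x : ℝ) :
    HasDerivAt (fun t : ℝ ↦ t * max t 0) (2 * max x 0) x := by
  rcases lt_trichotomy x 0 with hx | rfl | hx
  · rw [max_eq_right hx.le, mul_zero]
    refine (hasDerivAt_const x (0 : ℝ)).congr_of_eventuallyEq ?_
    filter_upwards [Iio_mem_nhds hx] with t ht
    rw [max_eq_right (le_of_lt ht), mul_zero]
  · rw [max_self, mul_zero, hasDerivAt_iff_isLittleO]
    simp only [max_self, mul_zero, sub_zero, smul_zero]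
    simpa using (Asymptotics.isBigO_refl (fun t : ℝ ↦ t) (nhds 0)).mul_isLittleO
      ((Asymptotics.isLittleO_one_iff ℝ).2
        (show Filter.Tendsto (fun t : ℝ ↦ max t 0) (nhds 0) (nhds 0) by
          have : Continuous fun t : ℝ ↦ max t 0 := by fun_prop
          simpa using this.tendsto 0))
  · rw [max_eq_left hx.le]
    refine (((hasDerivAt_id x).mul (hasDerivAt_id x)).congr_deriv
      (by simp; ring)).congr_of_eventuallyEq ?_
    filter_upwards [Ioi_mem_nhds hx] with t ht
    simp [max_eq_left (show (0 : ℝ) ≤ t from le_of_lt ht)]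

theorem hasLineDerivAt_coord_mul_posPart :
    HasLineDerivAt ℝ (fun ξ : EuclideanSpace ℝ (Fin N) ↦ ξ i * max (ξ k) 0)
      ((1 + if i = k then 1 else 0) * max (ξ k) 0) ξ (EuclideanSpace.single i 1) := by
  unfold HasLineDerivAt
  rcases eq_or_ne i k with rfl | h
  · have hlin : HasDerivAt (fun t : ℝ ↦ ξ i + t) 1 0 := (hasDerivAt_id 0).const_add _
    have := (hasDerivAt_mul_posPart (ξ i + 0)).comp (0 : ℝ) hlin
    simpa [Function.comp_def, one_add_one_eq_two] using this
  · have hlin : HasDerivAt (fun t : ℝ ↦ (ξ i + t) * max (ξ k) 0) (1 * max (ξ k) 0) 0 :=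
      ((hasDerivAt_id 0).const_add _).mul_const _
    simpa [h, h.symm] using hlin

/-- Integration by parts of `ξᵢ ξₖ⁺ (1 + |ξ|²)^a` in the direction `eᵢ`. -/
theorem integral_coord_sq_mul_posPart_mul_rpow (ha : a < -(N : ℝ) / 2 - 1) :
    (1 + if i = k then 1 else 0) *
        ∫ ξ : EuclideanSpace ℝ (Fin N), max (ξ k) 0 * (1 + ‖ξ‖ ^ 2) ^ a =
      -(2 * a) * ∫ ξ : EuclideanSpace ℝ (Fin N),
        ξ i ^ 2 * max (ξ k) 0 * (1 + ‖ξ‖ ^ 2) ^ (a - 1) := by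
  have hK := (integrable_posPart_mul_rpow k a ha).const_mul (1 + if i = k then (1 : ℝ) else 0)
  have hJ := (integrable_coord_sq_mul_posPart_mul_rpow i k a ha).const_mul (2 * a)
  have key := integral_bilinear_hasLineDerivAt_right_eq_neg_left_of_integrable
    (μ := (volume : Measure (EuclideanSpace ℝ (Fin N)))) (B := ContinuousLinearMap.mul ℝ ℝ)
    (v := EuclideanSpace.single i 1)
    (f := fun ξ ↦ (1 + ‖ξ‖ ^ 2) ^ a) (f' := fun ξ ↦ 2 * a * ξ i * (1 + ‖ξ‖ ^ 2) ^ (a - 1))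
    (g := fun ξ ↦ ξ i * max (ξ k) 0)
    (g' := fun ξ ↦ (1 + if i = k then 1 else 0) * max (ξ k) 0)
    (hJ.congr (.of_forall fun ξ ↦ by simp only [ContinuousLinearMap.mul_apply']; ring))
    (hK.congr (.of_forall fun ξ ↦ by simp only [ContinuousLinearMap.mul_apply']; ring))
    ((integrable_coord_mul_posPart_mul_rpow i k a ha).congr
      (.of_forall fun ξ ↦ by simp only [ContinuousLinearMap.mul_apply']; ring))
    (fun ξ _ ↦ by
      convert! (hasFDerivAt_one_add_norm_sq_rpow a ξ).hasLineDerivAt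
        (EuclideanSpace.single i 1) using 1
      simp [EuclideanSpace.inner_single_right]
      ring)
    (fun ξ _ ↦ hasLineDerivAt_coord_mul_posPart i k ξ)
  simp only [ContinuousLinearMap.mul_apply'] at key
  rw [neg_mul, ← integral_const_mul, ← integral_const_mul]
  refine (Eq.trans ?_ key).trans (congrArg Neg.neg ?_) <;>
    exact integral_congr_ae (.of_forall fun ξ ↦ by ring)

/-- Integrating `div (ξ ξₖ⁺ (1 + |ξ|²)^a)` relates consecutive powers of the bracket. -/
theorem integral_posPart_mul_rpow_sub_one (ha : a < -(N : ℝ) / 2 - 1) :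
    ((N : ℝ) + 1 + 2 * a) * ∫ ξ : EuclideanSpace ℝ (Fin N), max (ξ k) 0 * (1 + ‖ξ‖ ^ 2) ^ a =
      2 * a * ∫ ξ : EuclideanSpace ℝ (Fin N), max (ξ k) 0 * (1 + ‖ξ‖ ^ 2) ^ (a - 1) := by
  have hsum : ∑ i, ∫ ξ : EuclideanSpace ℝ (Fin N),
        ξ i ^ 2 * max (ξ k) 0 * (1 + ‖ξ‖ ^ 2) ^ (a - 1) =
      (∫ ξ : EuclideanSpace ℝ (Fin N), max (ξ k) 0 * (1 + ‖ξ‖ ^ 2) ^ a) -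
        ∫ ξ : EuclideanSpace ℝ (Fin N), max (ξ k) 0 * (1 + ‖ξ‖ ^ 2) ^ (a - 1) := by
    rw [← integral_finsetSum _ fun i _ ↦ integrable_coord_sq_mul_posPart_mul_rpow i k a ha,
      ← integral_sub (integrable_posPart_mul_rpow k a ha)
        (integrable_posPart_mul_rpow k (a - 1) (by linarith))]
    congr 1
    ext ξ
    have hJ := one_add_norm_sq_pos ξ
    have e : (1 + ‖ξ‖ ^ 2) ^ a = (1 + ‖ξ‖ ^ 2) ^ (a - 1) * (1 + ‖ξ‖ ^ 2) := by
      rw [← Real.rpow_add_one hJ.ne', sub_add_cancel]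
    rw [← Finset.sum_mul, ← Finset.sum_mul, ← EuclideanSpace.real_norm_sq_eq, e]
    ring
  have h := Finset.sum_congr rfl
    fun i (_ : i ∈ Finset.univ) ↦ integral_coord_sq_mul_posPart_mul_rpow i k a ha
  rw [← Finset.mul_sum, hsum, ← Finset.sum_mul, Finset.sum_add_distrib,
    Finset.sum_ite_eq' Finset.univ k] at h
  simp only [Finset.sum_const, Finset.card_univ, Fintype.card_fin, nsmul_eq_mul, mul_one,
    Finset.mem_univ, if_true] at h
  linarith

end PositivePart

theorem setIntegral_upperHalf_coord_mul {N : ℕ} (h : 0 < N)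
    (f : EuclideanSpace ℝ (Fin N) → ℝ) :
    ∫ ξ in upperHalf N h, ξ (lastIdx N h) * f ξ = ∫ ξ, max (ξ (lastIdx N h)) 0 * f ξ := by
  have hmeas : MeasurableSet (upperHalf N h) :=
    measurableSet_lt measurable_const (by fun_prop)
  rw [← integral_indicator hmeas]
  congr 1
  ext ξ
  by_cases hξ : 0 < ξ (lastIdx N h)
  · rw [Set.indicator_of_mem (show ξ ∈ upperHalf N h from hξ), max_eq_left hξ.le]
  · rw [Set.indicator_of_notMem (show ξ ∉ upperHalf N h from hξ), max_eq_right (not_lt.1 hξ),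
      zero_mul]

theorem w0_rpow {N : ℕ} (hN : 5 ≤ N) (ξ : EuclideanSpace ℝ (Fin N)) :
    w0 N ξ ^ (2 * (N : ℝ) / ((N : ℝ) - 2)) =
      ((N : ℝ) * ((N : ℝ) - 2)) ^ ((N : ℝ) / 2) * (1 + ‖ξ‖ ^ 2) ^ (-(N : ℝ)) := by
  have hN' : (5 : ℝ) ≤ N := by exact_mod_cast hN
  have h2 : (N : ℝ) - 2 ≠ 0 := by linarith
  have hA : 0 ≤ (N : ℝ) * ((N : ℝ) - 2) := mul_nonneg (by linarith) (by linarith)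
  have hJ := one_add_norm_sq_pos ξ
  rw [w0, Real.mul_rpow (Real.rpow_nonneg hA _) (Real.rpow_nonneg hJ.le _), ← Real.rpow_mul hA,
    ← Real.rpow_mul hJ.le]
  congr 2 <;> field_simp
  norm_num

theorem pd_w0_sq {N : ℕ} (hN : 5 ≤ N) (i : Fin N) (ξ : EuclideanSpace ℝ (Fin N)) :
    pd i (w0 N) ξ ^ 2 =
      ((N : ℝ) * ((N : ℝ) - 2)) ^ (((N : ℝ) - 2) / 2) * ((N : ℝ) - 2) ^ 2 *
        (ξ i ^ 2 * (1 + ‖ξ‖ ^ 2) ^ (-(N : ℝ))) := by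
  have hN' : (5 : ℝ) ≤ N := by exact_mod_cast hN
  have hA : 0 ≤ (N : ℝ) * ((N : ℝ) - 2) := mul_nonneg (by linarith) (by linarith)
  have hJ := one_add_norm_sq_pos ξ
  have hd := (hasFDerivAt_one_add_norm_sq_rpow (-(((N : ℝ) - 2) / 2)) ξ).const_mul
    (((N : ℝ) * ((N : ℝ) - 2)) ^ (((N : ℝ) - 2) / 4))
  have e1 : ((N : ℝ) * ((N : ℝ) - 2)) ^ (((N : ℝ) - 2) / 2) =
      (((N : ℝ) * ((N : ℝ) - 2)) ^ (((N : ℝ) - 2) / 4)) ^ 2 := by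
    rw [← Real.rpow_mul_natCast hA]
    congr 1
    push_cast
    ring
  have e2 : (1 + ‖ξ‖ ^ 2) ^ (-(N : ℝ)) =
      ((1 + ‖ξ‖ ^ 2) ^ (-(((N : ℝ) - 2) / 2) - 1)) ^ 2 := by
    rw [← Real.rpow_mul_natCast hJ.le]
    congr 1
    push_cast
    ring
  have hpd : pd i (w0 N) ξ = ((N : ℝ) * ((N : ℝ) - 2)) ^ (((N : ℝ) - 2) / 4) *
      (-((N : ℝ) - 2) * (ξ i * (1 + ‖ξ‖ ^ 2) ^ (-(((N : ℝ) - 2) / 2) - 1))) := by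
    unfold pd
    rw [show fderiv ℝ (w0 N) ξ = _ from hd.fderiv]
    simp [EuclideanSpace.inner_single_right]
    ring
  rw [hpd, e1, e2]
  ring

/-- `∫_{ℝ^N₊} ξ_N w₀^{2N/(N-2)} = (N(N-3)/(N-2)) 𝔄₁`, where
`𝔄₁ = ∫_{ℝ^N₊} ξ_N |∂w₀/∂ξ₁|²`. -/
theorem stmt6 (N : ℕ) (hN : 5 ≤ N) :
    (∫ ξ in upperHalf N (by omega),
        ξ (lastIdx N (by omega)) * w0 N ξ ^ (2 * (N : ℝ) / ((N : ℝ) - 2)))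
      = ((N : ℝ) * ((N : ℝ) - 3) / ((N : ℝ) - 2)) *
          ∫ ξ in upperHalf N (by omega),
            ξ (lastIdx N (by omega)) * (pd (⟨0, by omega⟩ : Fin N) (w0 N) ξ) ^ 2 := by
  have hN' : (5 : ℝ) ≤ N := by exact_mod_cast hN
  have hpos : 0 < N := by omega
  have hA : 0 < (N : ℝ) * ((N : ℝ) - 2) := mul_pos (by linarith) (by linarith)
  have h2 : (N : ℝ) - 2 ≠ 0 := by linarith
  have hne : (⟨0, by omega⟩ : Fin N) ≠ lastIdx N hpos := by
    simp only [lastIdx, ne_eq, Fin.mk.injEq]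
    omega
  have ha : 1 - (N : ℝ) < -(N : ℝ) / 2 - 1 := by linarith
  have hB := integral_coord_sq_mul_posPart_mul_rpow (⟨0, by omega⟩ : Fin N) (lastIdx N hpos) _ ha
  have hC := integral_posPart_mul_rpow_sub_one (lastIdx N hpos) _ ha
  rw [if_neg hne, add_zero, one_mul] at hB
  rw [hB, show (1 : ℝ) - N - 1 = -(N : ℝ) by ring] at hC
  rw [setIntegral_upperHalf_coord_mul hpos fun ξ ↦ w0 N ξ ^ (2 * (N : ℝ) / ((N : ℝ) - 2)),
    setIntegral_upperHalf_coord_mul hpos fun ξ ↦ pd (⟨0, by omega⟩ : Fin N) (w0 N) ξ ^ 2]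
  simp only [w0_rpow hN, pd_w0_sq hN, mul_left_comm (max _ _)]
  rw [integral_const_mul, integral_const_mul]
  have e : ((N : ℝ) * ((N : ℝ) - 2)) ^ ((N : ℝ) / 2) =
      ((N : ℝ) * ((N : ℝ) - 2)) ^ (((N : ℝ) - 2) / 2) * ((N : ℝ) * ((N : ℝ) - 2)) := by
    rw [← Real.rpow_add_one hA.ne']
    congr 1
    ring
  have hD : ∫ ξ : EuclideanSpace ℝ (Fin N),
        max (ξ (lastIdx N hpos)) 0 * (1 + ‖ξ‖ ^ 2) ^ (-(N : ℝ)) =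
      ((N : ℝ) - 3) * ∫ ξ : EuclideanSpace ℝ (Fin N), ξ (⟨0, by omega⟩ : Fin N) ^ 2 *
        (max (ξ (lastIdx N hpos)) 0 * (1 + ‖ξ‖ ^ 2) ^ (-(N : ℝ))) := by
    have h1 : 2 * (1 - (N : ℝ)) ≠ 0 := by linarith
    refine mul_left_cancel₀ h1 ?_
    rw [← hC]
    simp only [mul_assoc]
    ring
  rw [hD, e]
  field_simp
end
end

section
/- One has ∫_{ℝ^N₊} Z₀(ξ) ∂w₀/∂ξ_N(ξ) dξ = 𝔄₀. -/
open MeasureTheory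

noncomputable section

theorem pd_w0 {N : ℕ} (i : Fin N) (ξ : EuclideanSpace ℝ (Fin N)) :
    pd i (w0 N) ξ = ((N : ℝ) * ((N : ℝ) - 2)) ^ (((N : ℝ) - 2) / 4) *
      (-((N : ℝ) - 2) * ξ i * (1 + ‖ξ‖ ^ 2) ^ (-((N : ℝ) / 2))) := by
  have hpos : (1 + ‖ξ‖ ^ 2 : ℝ) ≠ 0 := by positivity
  have h := (((hasStrictFDerivAt_norm_sq ξ).hasFDerivAt.const_add 1).rpow_const
    (p := -(((N : ℝ) - 2) / 2)) (Or.inl hpos)).const_mul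
      (((N : ℝ) * ((N : ℝ) - 2)) ^ (((N : ℝ) - 2) / 4))
  have h' : HasFDerivAt (w0 N) _ ξ := h
  rw [pd, h'.fderiv]
  have e : -(((N : ℝ) - 2) / 2) - 1 = -((N : ℝ) / 2) := by ring
  simp [e, EuclideanSpace.inner_single_right]
  ring

/-- `α_N ^ (2N/(N-2)) = N (N-2) α_N²`. -/
theorem w0_amplitude_rpow {N : ℕ} (hN : 5 ≤ N) :
    (((N : ℝ) * ((N : ℝ) - 2)) ^ (((N : ℝ) - 2) / 4)) ^ (2 * (N : ℝ) / ((N : ℝ) - 2)) =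
      (N : ℝ) * ((N : ℝ) - 2) * (((N : ℝ) * ((N : ℝ) - 2)) ^ (((N : ℝ) - 2) / 4)) ^ 2 := by
  have hN' : (5 : ℝ) ≤ N := by exact_mod_cast hN
  have hk : (N : ℝ) - 2 ≠ 0 := by linarith
  have hb : 0 < (N : ℝ) * ((N : ℝ) - 2) := mul_pos (by linarith) (by linarith)
  rw [← Real.rpow_mul hb.le, ← Real.rpow_natCast, ← Real.rpow_mul hb.le,
    ← Real.rpow_one_add' hb.le (by push_cast; linarith)]
  congr 1
  push_cast
  field_simp
  ring

theorem w0_rpow_critical {N : ℕ} (hN : 5 ≤ N) (ξ : EuclideanSpace ℝ (Fin N)) :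
    w0 N ξ ^ (2 * (N : ℝ) / ((N : ℝ) - 2)) =
      (N : ℝ) * ((N : ℝ) - 2) * (((N : ℝ) * ((N : ℝ) - 2)) ^ (((N : ℝ) - 2) / 4)) ^ 2 *
        (1 + ‖ξ‖ ^ 2) ^ (-(N : ℝ)) := by
  have hN' : (5 : ℝ) ≤ N := by exact_mod_cast hN
  have hk : (N : ℝ) - 2 ≠ 0 := by linarith
  have hb : 0 < (N : ℝ) * ((N : ℝ) - 2) := mul_pos (by linarith) (by linarith)
  rw [w0, Real.mul_rpow (by positivity) (by positivity), w0_amplitude_rpow hN,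
    ← Real.rpow_mul (by positivity)]
  congr 2
  field_simp

theorem rpow_neg_half_sq {N : ℕ} (ξ : EuclideanSpace ℝ (Fin N)) :
    ((1 + ‖ξ‖ ^ 2) ^ (-((N : ℝ) / 2))) ^ 2 = (1 + ‖ξ‖ ^ 2) ^ (-(N : ℝ)) := by
  rw [← Real.rpow_natCast, ← Real.rpow_mul (by positivity)]
  congr 1
  push_cast
  ring

theorem sum_pd_w0_sq {N : ℕ} (ξ : EuclideanSpace ℝ (Fin N)) :
    ∑ i, (pd i (w0 N) ξ) ^ 2 =
      ((N : ℝ) - 2) ^ 2 * (((N : ℝ) * ((N : ℝ) - 2)) ^ (((N : ℝ) - 2) / 4)) ^ 2 *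
        (‖ξ‖ ^ 2 * (1 + ‖ξ‖ ^ 2) ^ (-(N : ℝ))) := by
  simp only [pd_w0]
  rw [← rpow_neg_half_sq]
  conv_rhs => rw [EuclideanSpace.real_norm_sq_eq ξ, Finset.sum_mul, Finset.mul_sum]
  rw [← EuclideanSpace.real_norm_sq_eq ξ]
  exact Finset.sum_congr rfl fun i _ => by ring

theorem Zdil_eq {N : ℕ} (ξ : EuclideanSpace ℝ (Fin N)) :
    Zdil N ξ = ((N : ℝ) * ((N : ℝ) - 2)) ^ (((N : ℝ) - 2) / 4) * (((N : ℝ) - 2) / 2) *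
      (1 - ‖ξ‖ ^ 2) * (1 + ‖ξ‖ ^ 2) ^ (-((N : ℝ) / 2)) := by
  have hs : ∑ i, ξ i * pd i (w0 N) ξ = ((N : ℝ) * ((N : ℝ) - 2)) ^ (((N : ℝ) - 2) / 4) *
      (-((N : ℝ) - 2) * ‖ξ‖ ^ 2 * (1 + ‖ξ‖ ^ 2) ^ (-((N : ℝ) / 2))) := by
    have hsum : ‖ξ‖ ^ 2 = ∑ i, ξ i ^ 2 := EuclideanSpace.real_norm_sq_eq ξ
    simp only [pd_w0]
    generalize (1 + ‖ξ‖ ^ 2) ^ (-((N : ℝ) / 2)) = c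
    rw [hsum, Finset.mul_sum, Finset.sum_mul, Finset.mul_sum]
    exact Finset.sum_congr rfl fun i _ => by ring
  have hw : (1 + ‖ξ‖ ^ 2) ^ (-(((N : ℝ) - 2) / 2)) =
      (1 + ‖ξ‖ ^ 2) ^ (-((N : ℝ) / 2)) * (1 + ‖ξ‖ ^ 2) := by
    rw [← Real.rpow_add_one (by positivity)]
    congr 1
    ring
  rw [Zdil, hs, w0, hw]
  ring

theorem integrable_coord_mul_rpow {N : ℕ} (hN : 5 ≤ N) (i : Fin N)
    {g : EuclideanSpace ℝ (Fin N) → ℝ} (hg : Continuous g)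
    (hle : ∀ ξ, |g ξ| ≤ 1 + ‖ξ‖ ^ 2) :
    Integrable fun ξ : EuclideanSpace ℝ (Fin N) =>
      ξ i * (g ξ * (1 + ‖ξ‖ ^ 2) ^ (-(N : ℝ))) := by
  have hN' : (5 : ℝ) ≤ N := by exact_mod_cast hN
  have hcont : Continuous fun ξ : EuclideanSpace ℝ (Fin N) =>
      ξ i * (g ξ * (1 + ‖ξ‖ ^ 2) ^ (-(N : ℝ))) := by
    have : Continuous fun ξ : EuclideanSpace ℝ (Fin N) => (1 + ‖ξ‖ ^ 2) ^ (-(N : ℝ)) :=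
      Continuous.rpow_const (by fun_prop) fun ξ => Or.inl (by positivity)
    fun_prop
  refine (integrable_rpow_neg_one_add_norm_sq (r := 2 * (N : ℝ) - 3)
    (by rw [finrank_euclideanSpace_fin]; linarith)).mono' hcont.aestronglyMeasurable ?_
  refine Filter.Eventually.of_forall fun ξ => ?_
  have hpos : (0 : ℝ) < 1 + ‖ξ‖ ^ 2 := by positivity
  have hcoord : |ξ i| ≤ (1 + ‖ξ‖ ^ 2) ^ (1 / 2 : ℝ) := by
    rw [← Real.sqrt_eq_rpow]
    exact Real.le_sqrt_of_sq_le (by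
      have := sq_le_sq' (by linarith [norm_nonneg ξ, norm_nonneg (ξ i)])
        (PiLp.norm_apply_le ξ i)
      rw [Real.norm_eq_abs] at this
      linarith)
  calc ‖ξ i * (g ξ * (1 + ‖ξ‖ ^ 2) ^ (-(N : ℝ)))‖
      = |ξ i| * (|g ξ| * (1 + ‖ξ‖ ^ 2) ^ (-(N : ℝ))) := by
        rw [Real.norm_eq_abs, abs_mul, abs_mul, abs_of_pos (Real.rpow_pos_of_pos hpos _)]
    _ ≤ (1 + ‖ξ‖ ^ 2) ^ (1 / 2 : ℝ) * ((1 + ‖ξ‖ ^ 2) * (1 + ‖ξ‖ ^ 2) ^ (-(N : ℝ))) := by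
        gcongr
        exact hle ξ
    _ = (1 + ‖ξ‖ ^ 2) ^ (-(2 * (N : ℝ) - 3) / 2) := by
        rw [← Real.rpow_one_add' hpos.le (by linarith), ← Real.rpow_add hpos]
        congr 1
        ring

/-- `∫_{ℝ^N₊} Z₀ ∂w₀/∂ξ_N = 𝔄₀`, where
`𝔄₀ = (1/2)∫ ξ_N |∇w₀|² - ((N-2)/(2N)) ∫ ξ_N w₀^{2N/(N-2)}`. -/
theorem stmt8 (N : ℕ) (hN : 5 ≤ N) :
    (∫ ξ in upperHalf N (by omega), Zdil N ξ * pd (lastIdx N (by omega)) (w0 N) ξ)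
      = (1 : ℝ) / 2 * (∫ ξ in upperHalf N (by omega),
          ξ (lastIdx N (by omega)) * ∑ i, (pd i (w0 N) ξ) ^ 2)
        - ((N : ℝ) - 2) / (2 * (N : ℝ)) * (∫ ξ in upperHalf N (by omega),
            ξ (lastIdx N (by omega)) * w0 N ξ ^ (2 * (N : ℝ) / ((N : ℝ) - 2))) := by
  have hN' : (5 : ℝ) ≤ N := by exact_mod_cast hN
  have hgrad : Integrable fun ξ : EuclideanSpace ℝ (Fin N) =>
      ξ (lastIdx N (by omega)) * ∑ i, (pd i (w0 N) ξ) ^ 2 := by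
    refine ((integrable_coord_mul_rpow hN (lastIdx N (by omega)) (g := fun ξ => ‖ξ‖ ^ 2)
      (by fun_prop) fun ξ => by rw [abs_of_nonneg (by positivity)]; linarith).const_mul
      (((N : ℝ) - 2) ^ 2 *
        (((N : ℝ) * ((N : ℝ) - 2)) ^ (((N : ℝ) - 2) / 4)) ^ 2)).congr
      (Filter.Eventually.of_forall fun ξ => ?_)
    simp only [sum_pd_w0_sq]
    ring
  have hcrit : Integrable fun ξ : EuclideanSpace ℝ (Fin N) =>
      ξ (lastIdx N (by omega)) * w0 N ξ ^ (2 * (N : ℝ) / ((N : ℝ) - 2)) := by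
    refine ((integrable_coord_mul_rpow hN (lastIdx N (by omega)) (g := fun _ => 1)
      continuous_const fun ξ => by rw [abs_one]; linarith [sq_nonneg ‖ξ‖]).const_mul
      ((N : ℝ) * ((N : ℝ) - 2) *
        (((N : ℝ) * ((N : ℝ) - 2)) ^ (((N : ℝ) - 2) / 4)) ^ 2)).congr
      (Filter.Eventually.of_forall fun ξ => ?_)
    simp only [w0_rpow_critical hN]
    ring
  rw [← integral_const_mul, ← integral_const_mul,
    ← integral_sub (hgrad.integrableOn.const_mul _) (hcrit.integrableOn.const_mul _)]
  congr 1
  funext ξ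
  rw [Zdil_eq, pd_w0, sum_pd_w0_sq, w0_rpow_critical hN, ← rpow_neg_half_sq]
  field_simp
  ring
end
end

section
/- Resonance-avoidance lemma: let k be a positive integer and let γ₋, γ₊, C₀, σ* > 0. For each j ∈ ℕ let λ_j : (0, σ*) → ℝ be continuous, and assume: (i) for all 0 < σ₁ < σ₂ < σ* and all j ∈ ℕ, (σ₂−σ₁)·γ₋/(2σ₂²) ≤ λ_j(σ₂)/σ₂ − λ_j(σ₁)/σ₁ ≤ 2(σ₂−σ₁)·γ₊/σ₁²; (ii) for every σ ∈ (0, σ*) the set { j ∈ ℕ : λ_j(σ) < 0 } is finite with cardinality at most C₀ σ^{−k/2}. Then there exist c > 0, l₀ ∈ ℕ and, for every integer l ≥ l₀, a number σ_l ∈ (2^{−(l+1)}, 2^{−l}) such that |λ_j(σ_l)| ≥ c σ_l^{k/2} for all j ∈ ℕ. -/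
open MeasureTheory in
/-- If the sets `B j` are empty for `j` outside a finite set `F`, have diameter at most `L`, and
`F.card * L < b - a`, then some point of `(a, b)` avoids all of them. -/
theorem exists_mem_Ioo_forall_notMem_of_diam_le {ι : Type*} (F : Finset ι) (B : ι → Set ℝ)
    {a b L : ℝ} (hL : 0 ≤ L) (hout : ∀ j, j ∉ F → B j = ∅)
    (hdiam : ∀ j, ∀ x ∈ B j, ∀ y ∈ B j, x < y → y - x ≤ L)
    (hlt : F.card * L < b - a) : ∃ x ∈ Set.Ioo a b, ∀ j, x ∉ B j := by
  by_contra! h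
  have hsub : Set.Ioo a b ⊆ ⋃ j ∈ F, B j := by
    intro x hx
    obtain ⟨j, hj⟩ := h x hx
    have hjF : j ∈ F := by
      by_contra hn
      simp [hout j hn] at hj
    exact Set.mem_biUnion (Finset.mem_coe.2 hjF) hj
  have hvol : ∀ j, volume (B j) ≤ ENNReal.ofReal L := by
    intro j
    refine (Real.volume_le_diam _).trans (Metric.ediam_le fun x hx y hy => ?_)
    rw [edist_dist]
    refine ENNReal.ofReal_le_ofReal ?_
    rw [Real.dist_eq, abs_sub_le_iff]
    constructor
    · rcases lt_or_ge y x with hxy | hxy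
      · exact hdiam j y hy x hx hxy
      · linarith
    · rcases lt_or_ge x y with hxy | hxy
      · exact hdiam j x hx y hy hxy
      · linarith
  have hle : ENNReal.ofReal (b - a) ≤ ENNReal.ofReal (F.card * L) := by
    calc ENNReal.ofReal (b - a) = volume (Set.Ioo a b) := Real.volume_Ioo.symm
      _ ≤ ∑ j ∈ F, volume (B j) := (measure_mono hsub).trans (measure_biUnion_finset_le F B)
      _ ≤ ∑ _j ∈ F, ENNReal.ofReal L := Finset.sum_le_sum fun j _ => hvol j
      _ = ENNReal.ofReal (F.card * L) := by
        rw [Finset.sum_const, nsmul_eq_mul, ENNReal.ofReal_mul (Nat.cast_nonneg _),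
          ENNReal.ofReal_natCast]
  have := (ENNReal.ofReal_le_ofReal_iff (by positivity)).1 hle
  linarith

/-- resonance-avoidance lemma.  Under the quantitative
monotonicity bound (i) and the counting bound (ii) on the continuous families
`λ_j`, there are `c > 0` and, for every large `l`, a parameter
`σ_l ∈ (2^{-(l+1)}, 2^{-l})` with `|λ_j(σ_l)| ≥ c σ_l^{k/2}` for all `j`. -/
theorem stmt18 (k : ℕ) (hk : 0 < k) (γm γp C0 σs : ℝ)
    (hγm : 0 < γm) (hγp : 0 < γp) (hC0 : 0 < C0) (hσs : 0 < σs)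
    (lam : ℕ → ℝ → ℝ)
    (hcont : ∀ j : ℕ, ContinuousOn (lam j) (Set.Ioo 0 σs))
    (hmono : ∀ j : ℕ, ∀ σ1 σ2 : ℝ, 0 < σ1 → σ1 < σ2 → σ2 < σs →
      (σ2 - σ1) * γm / (2 * σ2 ^ 2) ≤ lam j σ2 / σ2 - lam j σ1 / σ1 ∧
      lam j σ2 / σ2 - lam j σ1 / σ1 ≤ 2 * (σ2 - σ1) * γp / σ1 ^ 2)
    (hcount : ∀ σ : ℝ, 0 < σ → σ < σs →
      {j : ℕ | lam j σ < 0}.Finite ∧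
      ({j : ℕ | lam j σ < 0}.ncard : ℝ) ≤ C0 * σ ^ (-(k : ℝ) / 2)) :
    ∃ c > (0 : ℝ), ∃ l0 : ℕ, ∀ l : ℕ, l0 ≤ l →
      ∃ σl : ℝ, (2 : ℝ) ^ (-(l : ℤ) - 1) < σl ∧ σl < (2 : ℝ) ^ (-(l : ℤ)) ∧
        ∀ j : ℕ, c * σl ^ ((k : ℝ) / 2) ≤ |lam j σl| := by
  have key : ∀ x y : ℝ, 0 < x → x < y → y < σs → ∀ b, y ≤ b → ∀ j,
      (y - x) * γm / (2 * b ^ 2) ≤ lam j y / y - lam j x / x := by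
    intro x y hx hxy hy b hb j
    refine le_trans ?_ (hmono j x y hx hxy hy).1
    have hy0 : 0 < y := hx.trans hxy
    have hd : 0 ≤ (y - x) * γm := mul_nonneg (by linarith) hγm.le
    gcongr
  set c : ℝ := min (γm / 16) (γm / (32 * 2 ^ k * C0)) with hc
  have hc0 : 0 < c := lt_min (by positivity) (by positivity)
  obtain ⟨l0, hl0⟩ := exists_pow_lt_of_lt_one hσs (by norm_num : (1 / 2 : ℝ) < 1)
  refine ⟨c, hc0, l0, fun l hl => ?_⟩
  obtain ⟨b, hb⟩ : ∃ b : ℝ, b = (2 : ℝ) ^ (-(l : ℤ)) := ⟨_, rfl⟩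
  have hb' : (2 : ℝ) ^ (-(l : ℤ) - 1) = b / 2 := by
    rw [hb, zpow_sub_one₀ two_ne_zero, div_eq_mul_inv]
  have hbpow : b = (1 / 2 : ℝ) ^ l := by rw [hb]; simp
  have hb0 : 0 < b := by rw [hbpow]; positivity
  have hb1 : b ≤ 1 := by rw [hbpow]; exact pow_le_one₀ (by norm_num) (by norm_num)
  have hbs : b < σs := by
    rw [hbpow]
    exact (pow_le_pow_of_le_one (by norm_num) (by norm_num) hl).trans_lt hl0
  obtain ⟨P, hP⟩ : ∃ P : ℝ, P = b ^ ((k : ℝ) / 2) := ⟨_, rfl⟩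
  have hP0 : 0 < P := hP ▸ Real.rpow_pos_of_pos hb0 _
  have hP1 : P ≤ 1 := hP ▸ Real.rpow_le_one hb0.le hb1 (by positivity)
  have hcP : c * P ≤ γm / 16 :=
    (mul_le_of_le_one_right hc0.le hP1).trans (min_le_left _ _)
  obtain ⟨hfin, hcard⟩ := hcount (b / 4) (by positivity) (by linarith)
  have hquarter : (b / 4) ^ (-(k : ℝ) / 2) = 2 ^ k / P := by
    have h4 : (4 : ℝ) ^ ((k : ℝ) / 2) = 2 ^ k := by
      rw [show (4 : ℝ) = 2 ^ (2 : ℝ) by norm_num, ← Real.rpow_mul (by norm_num),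
        mul_div_cancel₀ _ two_ne_zero, Real.rpow_natCast]
    rw [neg_div, Real.rpow_neg (by positivity), Real.div_rpow hb0.le (by norm_num), h4, ← hP,
      inv_div]
  rw [hquarter, Set.ncard_eq_toFinset_card _ hfin] at hcard
  have hbad : ∀ j, ∀ x ∈ Set.Ioo (b / 2) b, |lam j x| < c * x ^ ((k : ℝ) / 2) →
      |lam j x / x| < 2 * (c * P) / b := by
    intro j x hx h
    have hx0 : 0 < x := lt_trans (by positivity) hx.1
    have hxP : x ^ ((k : ℝ) / 2) ≤ P :=
      hP ▸ Real.rpow_le_rpow hx0.le hx.2.le (by positivity)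
    have h1 : |lam j x| < c * P := h.trans_le (mul_le_mul_of_nonneg_left hxP hc0.le)
    rw [abs_div, abs_of_pos hx0, div_lt_div_iff₀ hx0 hb0]
    nlinarith [hx.1, mul_pos hc0 hP0]
  have hex := exists_mem_Ioo_forall_notMem_of_diam_le (a := b / 2) (b := b)
    (L := 8 * b * (c * P) / γm) hfin.toFinset
    (fun j => {x | x ∈ Set.Ioo (b / 2) b ∧ |lam j x| < c * x ^ ((k : ℝ) / 2)})
    (by positivity) ?hout ?hdiam ?hlt
  · obtain ⟨x, hx, hxB⟩ := hex
    refine ⟨x, hb' ▸ hx.1, hb ▸ hx.2, fun j => ?_⟩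
    by_contra! h
    exact hxB j ⟨hx, h⟩
  · intro j hj
    by_contra hne
    obtain ⟨x, hx, h⟩ := Set.nonempty_iff_ne_empty.2 hne
    refine hj (hfin.mem_toFinset.2 ?_)
    have h1 := (abs_lt.1 (hbad j x hx h)).2
    have h2 := key (b / 4) x (by positivity) (by linarith [hx.1]) (by linarith [hx.2]) b hx.2.le j
    have h3 : 2 * (c * P) / b ≤ (b / 4) * γm / (2 * b ^ 2) := by
      rw [div_le_div_iff₀ hb0 (by positivity)]
      nlinarith [mul_le_mul_of_nonneg_right hcP (sq_nonneg b)]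
    have h4 : (b / 4) * γm / (2 * b ^ 2) ≤ (x - b / 4) * γm / (2 * b ^ 2) := by
      have := hx.1
      gcongr
      linarith
    have h5 : lam j (b / 4) / (b / 4) < 0 := by linarith
    exact (div_neg_iff.1 h5).elim (fun h => absurd h.2 (by linarith)) fun h => h.1
  · rintro j x ⟨hx, hxlt⟩ y ⟨hy, hylt⟩ hxy
    have h1 := (abs_lt.1 (hbad j x hx hxlt)).1
    have h2 := (abs_lt.1 (hbad j y hy hylt)).2
    have h3 := key x y (by linarith [hx.1]) hxy (by linarith [hy.2]) b hy.2.le j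
    have h4 : (y - x) * γm / (2 * b ^ 2) ≤ 4 * (c * P) / b := by
      have : 4 * (c * P) / b = 2 * (c * P) / b + 2 * (c * P) / b := by ring
      linarith
    rw [div_le_div_iff₀ (by positivity) hb0] at h4
    rw [le_div_iff₀ hγm]
    exact le_of_mul_le_mul_right (by linarith) hb0
  · have hc2 : c * (32 * 2 ^ k * C0) ≤ γm := (le_div_iff₀ (by positivity)).1 (min_le_right _ _)
    calc (hfin.toFinset.card : ℝ) * (8 * b * (c * P) / γm)
        ≤ C0 * (2 ^ k / P) * (8 * b * (c * P) / γm) :=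
          mul_le_mul_of_nonneg_right hcard (by positivity)
      _ = c * (32 * 2 ^ k * C0) / γm * (b / 4) := by
          field_simp
          ring
      _ ≤ 1 * (b / 4) :=
          mul_le_mul_of_nonneg_right ((div_le_one hγm).2 hc2) (by positivity)
      _ < b - b / 2 := by linarith
end
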